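/- For t ∈ [-1, 0] and n ≥ 3, letting p = (8n²t⁴(2n-1) - 9n²t³(n-1) + (2nt² - 3t + 4)(7n+1)) / (2(1-t)(1 + 7n - 2n²t³(2n-1))) and f(n,t) = p²n(1-t)²/(2(nt²+1)), one has f(n,t) ≤ (16t-9)²/(128t²) for all t ∈ [-1, 0). -/

import Mathlib

/-- The cleared polynomial inequality after `n = 3 + m`, `t = -1 / (1 + u)`. -/
lemma poly_nonneg (m u : ℝ) (hm : 0 ≤ m) (hu : 0 ≤ u) :
    0 ≤ (22528) * (m ^ 0 * u ^ 0) + (-509696) * (m ^ 0 * u ^ 1) + (4367760) * (m ^ 0 * u ^ 2) + (10307192) * (m ^ 0 * u ^ 3) + (13571756) * (m ^ 0 * u ^ 4) + (11287716) * (m ^ 0 * u ^ 5) + (6466108) * (m ^ 0 * u ^ 6) + (2396284) * (m ^ 0 * u ^ 7) + (492228) * (m ^ 0 * u ^ 8) + (39204) * (m ^ 0 * u ^ 9) +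
      (156032) * (m ^ 1 * u ^ 0) + (-2300304) * (m ^ 1 * u ^ 1) + (2534476) * (m ^ 1 * u ^ 2) + (6954480) * (m ^ 1 * u ^ 3) + (9023272) * (m ^ 1 * u ^ 4) + (6730528) * (m ^ 1 * u ^ 5) + (3715516) * (m ^ 1 * u ^ 6) + (1440208) * (m ^ 1 * u ^ 7) + (313236) * (m ^ 1 * u ^ 8) + (24948) * (m ^ 1 * u ^ 9) +
      (395684) * (m ^ 2 * u ^ 0) + (-1913766) * (m ^ 2 * u ^ 1) + (452959) * (m ^ 2 * u ^ 2) + (1683505) * (m ^ 2 * u ^ 3) + (2265743) * (m ^ 2 * u ^ 4) + (1158817) * (m ^ 2 * u ^ 5) + (445325) * (m ^ 2 * u ^ 6) + (188699) * (m ^ 2 * u ^ 7) + (49833) * (m ^ 2 * u ^ 8) + (3969) * (m ^ 2 * u ^ 9) +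
      (352273) * (m ^ 3 * u ^ 0) + (-580537) * (m ^ 3 * u ^ 1) + (155713) * (m ^ 3 * u ^ 2) + (212371) * (m ^ 3 * u ^ 3) + (415395) * (m ^ 3 * u ^ 4) + (147725) * (m ^ 3 * u ^ 5) + (-11917) * (m ^ 3 * u ^ 6) + (-8575) * (m ^ 3 * u ^ 7) +
      (146636) * (m ^ 4 * u ^ 0) + (-26296) * (m ^ 4 * u ^ 1) + (108204) * (m ^ 4 * u ^ 2) + (4372) * (m ^ 4 * u ^ 3) + (43260) * (m ^ 4 * u ^ 4) + (30800) * (m ^ 4 * u ^ 5) + (4536) * (m ^ 4 * u ^ 6) +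
      (29756) * (m ^ 5 * u ^ 0) + (20932) * (m ^ 5 * u ^ 1) + (35552) * (m ^ 5 * u ^ 2) + (528) * (m ^ 5 * u ^ 3) + (-3528) * (m ^ 5 * u ^ 4) +
      (2400) * (m ^ 6 * u ^ 0) + (3264) * (m ^ 6 * u ^ 1) + (4464) * (m ^ 6 * u ^ 2) + (1296) * (m ^ 6 * u ^ 3) := by
  have P : ∀ i k : ℕ, 0 ≤ m ^ i * u ^ k := fun i k => by positivity
  have h0 : 0 ≤ 22528 - 509696 * u + 4367760 * u ^ 2 + 156032 * m - 2300304 * (u * m)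
      + 318684 * m ^ 2 := by
    nlinarith [sq_nonneg (352 - 3982 * u + 1219 * m), sq_nonneg (u - 0.1802 * m), sq_nonneg m]
  have h3 : 0 ≤ m * (2534476 * u ^ 2 - 1913766 * (u * m) + 361278 * m ^ 2) := by
    have : 0 ≤ 2534476 * u ^ 2 - 1913766 * (u * m) + 361278 * m ^ 2 := by
      nlinarith [sq_nonneg (5068952 * u - 1913766 * m), sq_nonneg m]
    positivity
  have h4 : 0 ≤ m ^ 2 * (915 * m ^ 2 - 16780 * (m * (1 : ℝ)) + 77000 * (1 : ℝ) ^ 2) := by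
    have : 0 ≤ 915 * m ^ 2 - 16780 * (m * (1 : ℝ)) + 77000 * (1 : ℝ) ^ 2 := by
      nlinarith [sq_nonneg (1830 * m - 16780 * (1 : ℝ)), sq_nonneg (1 : ℝ)]
    positivity
  have h5 : 0 ≤ m ^ 2 * (452959 * u ^ 2 - 510950 * (u * m) + 144092 * m ^ 2) := by
    have : 0 ≤ 452959 * u ^ 2 - 510950 * (u * m) + 144092 * m ^ 2 := by
      nlinarith [sq_nonneg (905918 * u - 510950 * m), sq_nonneg m]
    positivity
  have h6 : 0 ≤ m ^ 3 * (155713 * u ^ 2 - 69587 * (u * (1 : ℝ)) + 7775 * (1 : ℝ) ^ 2) := by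
    have : 0 ≤ 155713 * u ^ 2 - 69587 * (u * (1 : ℝ)) + 7775 * (1 : ℝ) ^ 2 := by
      nlinarith [sq_nonneg (311426 * u - 69587 * (1 : ℝ)), sq_nonneg (1 : ℝ)]
    positivity
  have h7 : 0 ≤ m ^ 4 * (108204 * u ^ 2 - 26296 * (u * (1 : ℝ)) + 1598 * (1 : ℝ) ^ 2) := by
    have : 0 ≤ 108204 * u ^ 2 - 26296 * (u * (1 : ℝ)) + 1598 * (1 : ℝ) ^ 2 := by
      nlinarith [sq_nonneg (216408 * u - 26296 * (1 : ℝ)), sq_nonneg (1 : ℝ)]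
    positivity
  have hA : 0 ≤ m ^ 4 * u ^ 3 * (1296 * m ^ 2 - 3528 * m * u + 30800 * u ^ 2) := by
    have : 0 ≤ 1296 * m ^ 2 - 3528 * m * u + 30800 * u ^ 2 := by
      nlinarith [sq_nonneg (36 * m - 49 * u), sq_nonneg u]
    positivity
  have hB : 0 ≤ m ^ 2 * u ^ 6 * (2268 * m ^ 2 - 8575 * m * u + 49833 * u ^ 2) := by
    have : 0 ≤ 2268 * m ^ 2 - 8575 * m * u + 49833 * u ^ 2 := by
      nlinarith [sq_nonneg (m - 1.9 * u), sq_nonneg u, sq_nonneg m]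
    positivity
  have hC : 0 ≤ m ^ 2 * u ^ 6 * (2268 * m ^ 2 - 11917 * m + 445325) := by
    have : 0 ≤ 2268 * m ^ 2 - 11917 * m + 445325 := by
      nlinarith [sq_nonneg (m - 2.6)]
    positivity
  linarith [
    P 0 0,
    P 0 2,
    P 0 3,
    P 0 4,
    P 0 5,
    P 0 6,
    P 0 7,
    P 0 8,
    P 0 9,
    P 1 0,
    P 1 2,
    P 1 3,
    P 1 4,
    P 1 5,
    P 1 6,
    P 1 7,
    P 1 8,
    P 1 9,
    P 2 0,
    P 2 2,
    P 2 3,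
    P 2 4,
    P 2 5,
    P 2 6,
    P 2 7,
    P 2 8,
    P 2 9,
    P 3 0,
    P 3 2,
    P 3 3,
    P 3 4,
    P 3 5,
    P 4 0,
    P 4 2,
    P 4 3,
    P 4 4,
    P 4 5,
    P 4 6,
    P 5 0,
    P 5 1,
    P 5 2,
    P 5 3,
    P 6 0,
    P 6 1,
    P 6 2,
    P 6 3]

theorem interpolation_asymptotic_bound (n t : ℝ) (hn : 3 ≤ n)
    (ht₀ : -1 ≤ t) (ht₁ : t < 0) :
    ((8 * n ^ 2 * t ^ 4 * (2 * n - 1) - 9 * n ^ 2 * t ^ 3 * (n - 1)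
        + (2 * n * t ^ 2 - 3 * t + 4) * (7 * n + 1))
      / (2 * (1 - t) * (1 + 7 * n - 2 * n ^ 2 * t ^ 3 * (2 * n - 1)))) ^ 2
      * n * (1 - t) ^ 2 / (2 * (n * t ^ 2 + 1))
    ≤ (16 * t - 9) ^ 2 / (128 * t ^ 2) := by
  obtain ⟨u, hu, rfl⟩ : ∃ u : ℝ, 0 ≤ u ∧ t = -(1 / (1 + u)) := by
    refine ⟨1 / (-t) - 1, ?_, ?_⟩
    · have : 1 ≤ 1 / (-t) := by
        rw [le_div_iff₀ (by linarith)]; linarith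
      linarith
    · have : t ≠ 0 := ht₁.ne
      field_simp
      ring
  obtain ⟨m, hm, rfl⟩ : ∃ m : ℝ, 0 ≤ m ∧ n = 3 + m := ⟨n - 3, by linarith, by ring⟩
  have key := poly_nonneg m u hm hu
  obtain ⟨s, hs⟩ : ∃ s : ℝ, s = 1 / (1 + u) := ⟨_, rfl⟩
  have hs0 : 0 < s := by rw [hs]; positivity
  obtain ⟨n, hnm⟩ : ∃ n : ℝ, n = 3 + m := ⟨_, rfl⟩
  have hF : 0 ≤ (16 * s + 9) ^ 2 * (1 + 7 * n + 2 * n ^ 2 * s ^ 3 * (2 * n - 1)) ^ 2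
        * (n * s ^ 2 + 1)
      - 16 * n * s ^ 2 * (8 * n ^ 2 * s ^ 4 * (2 * n - 1) + 9 * n ^ 2 * s ^ 3 * (n - 1)
        + (2 * n * s ^ 2 + 3 * s + 4) * (7 * n + 1)) ^ 2 := by
    have hus : u = 1 / s - 1 := by rw [hs]; field_simp; ring
    have hmn : m = n - 3 := by linarith
    have := mul_nonneg (pow_pos hs0 9).le key
    refine this.trans_eq ?_
    rw [hus, hmn]
    field_simp
    ring
  rw [← hnm] at hn
  rw [← hs, ← hnm]
  have hD : 0 < 1 + 7 * n + 2 * n ^ 2 * s ^ 3 * (2 * n - 1) := by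
    have : 0 < 2 * n - 1 := by linarith
    have : 0 < n := by linarith
    positivity
  have hn0 : 0 < n := by linarith
  generalize hDD : 1 + 7 * n + 2 * n ^ 2 * s ^ 3 * (2 * n - 1) = D at hD hF
  generalize hNN : 8 * n ^ 2 * s ^ 4 * (2 * n - 1) + 9 * n ^ 2 * s ^ 3 * (n - 1)
        + (2 * n * s ^ 2 + 3 * s + 4) * (7 * n + 1) = N at hF
  have e1 : 8 * n ^ 2 * (-s) ^ 4 * (2 * n - 1) - 9 * n ^ 2 * (-s) ^ 3 * (n - 1)
        + (2 * n * (-s) ^ 2 - 3 * (-s) + 4) * (7 * n + 1) = N := by rw [← hNN]; ring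
  have e2 : 1 + 7 * n - 2 * n ^ 2 * (-s) ^ 3 * (2 * n - 1) = D := by rw [← hDD]; ring
  rw [e1, e2]
  have e3 : (N / (2 * (1 - -s) * D)) ^ 2 * n * (1 - -s) ^ 2 / (2 * (n * (-s) ^ 2 + 1))
      = N ^ 2 * n / (8 * D ^ 2 * (n * s ^ 2 + 1)) := by
    have : 1 - -s ≠ 0 := by linarith
    have : (-s) ^ 2 = s ^ 2 := by ring
    rw [this]
    field_simp
    ring
  have e4 : (16 * -s - 9) ^ 2 / (128 * (-s) ^ 2) = (16 * s + 9) ^ 2 / (128 * s ^ 2) := by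
    congr 1 <;> ring
  rw [e3, e4, div_le_div_iff₀ (by positivity) (by positivity)]
  linarith
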